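/- arXiv:2002.08699 — 3 statements merged into one kernel-verified Lean document; each statement's English description precedes it below -/
import Mathlib

section
/- Let X be a Banach space, let ω ⊆ ℝⁿ be an open neighborhood of 0, and let K, L : ω → X be C¹-smooth maps with K(0) = L(0) such that both Fréchet derivatives DK(0), DL(0) : ℝⁿ → X are injective (have rank n). Suppose that for every neighborhood V ⊆ ω of 0 there is a neighborhood V₁ ⊆ ω of 0 such that K(V₁) ⊆ L(V). Then there exist neighborhoods 𝒱₁, 𝒱₂ ⊆ ω of 0 such that K(𝒱₁) = L(𝒱₂). -/
open Set Function Topology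

/-- Globevnik's Proposition 8.1.  Let `X` be a Banach space, `ω ⊆ ℝⁿ` an open
neighborhood of `0`, and `K, L : ω → X` `C¹`-smooth maps with `K 0 = L 0` whose Fréchet
derivatives at `0` are injective (have rank `n`).  If every neighborhood `V ⊆ ω` of `0` admits a
neighborhood `V₁ ⊆ ω` of `0` with `K(V₁) ⊆ L(V)`, then there are neighborhoods `𝒱₁, 𝒱₂ ⊆ ω`
of `0` with `K(𝒱₁) = L(𝒱₂)`. -/
theorem statement0 (n : ℕ) (X : Type*) [NormedAddCommGroup X] [NormedSpace ℝ X]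
    [CompleteSpace X]
    (ω : Set (EuclideanSpace ℝ (Fin n))) (hω : IsOpen ω)
    (h0 : (0 : EuclideanSpace ℝ (Fin n)) ∈ ω)
    (K L : EuclideanSpace ℝ (Fin n) → X)
    (hK : ContDiffOn ℝ 1 K ω) (hL : ContDiffOn ℝ 1 L ω)
    (hKL : K 0 = L 0)
    (hDK : Function.Injective (fderiv ℝ K 0))
    (hDL : Function.Injective (fderiv ℝ L 0))
    (hsub : ∀ V : Set (EuclideanSpace ℝ (Fin n)),
      V ∈ 𝓝 (0 : EuclideanSpace ℝ (Fin n)) → V ⊆ ω →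
      ∃ V₁ ∈ 𝓝 (0 : EuclideanSpace ℝ (Fin n)), V₁ ⊆ ω ∧ K '' V₁ ⊆ L '' V) :
    ∃ V₁ ∈ 𝓝 (0 : EuclideanSpace ℝ (Fin n)), ∃ V₂ ∈ 𝓝 (0 : EuclideanSpace ℝ (Fin n)),
      V₁ ⊆ ω ∧ V₂ ⊆ ω ∧ K '' V₁ = L '' V₂ := by
  have hω0 : ω ∈ 𝓝 (0 : EuclideanSpace ℝ (Fin n)) := hω.mem_nhds h0
  have hK' : HasStrictFDerivAt K (fderiv ℝ K 0) 0 :=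
    (hK.contDiffAt hω0).hasStrictFDerivAt one_ne_zero
  have hL' : HasStrictFDerivAt L (fderiv ℝ L 0) 0 :=
    (hL.contDiffAt hω0).hasStrictFDerivAt one_ne_zero
  obtain ⟨P, hP⟩ :=
    ContinuousLinearMap.HasLeftInverse.of_injective_of_isClosed_range_of_closedComplement_range
      hDL (Submodule.closed_of_finiteDimensional (fderiv ℝ L 0).range)
      (Submodule.ClosedComplemented.of_finiteDimensional _)
  have hPL : HasStrictFDerivAt (fun x => P (L x))
      ((ContinuousLinearEquiv.refl ℝ (EuclideanSpace ℝ (Fin n))) :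
        EuclideanSpace ℝ (Fin n) →L[ℝ] EuclideanSpace ℝ (Fin n)) 0 := by
    refine (P.hasStrictFDerivAt.comp (0 : EuclideanSpace ℝ (Fin n)) hL').congr_fderiv ?_
    exact ContinuousLinearMap.ext hP
  set g := hPL.localInverse _ _ _
  have hg' := hPL.to_localInverse
  have hgL : ∀ᶠ x in 𝓝 (0 : EuclideanSpace ℝ (Fin n)), g (P (L x)) = x :=
    hPL.eventually_left_inverse
  -- The transition map `φ` satisfies `K = L ∘ φ` near `0`.
  set φ : EuclideanSpace ℝ (Fin n) → EuclideanSpace ℝ (Fin n) := fun x => g (P (K x)) with hφ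
  have hφ0 : φ 0 = 0 := by
    simp only [hφ, hKL]
    exact hgL.self_of_nhds
  obtain ⟨φ', hφ'⟩ : ∃ φ', HasStrictFDerivAt φ φ' 0 := by
    rw [← hKL] at hg'
    exact ⟨_, hg'.comp (0 : EuclideanSpace ℝ (Fin n)) (P.hasStrictFDerivAt.comp _ hK')⟩
  obtain ⟨V₁, hV₁, hV₁ω, hKV⟩ := hsub _ (Filter.inter_mem hgL hω0) inter_subset_right
  have key : ∀ x ∈ V₁, φ x ∈ ω ∧ L (φ x) = K x := by
    intro x hx
    obtain ⟨v, ⟨hv, hvω⟩, hvK⟩ := hKV (mem_image_of_mem K hx)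
    have hφv : φ x = v := by
      simp only [hφ, ← hvK]
      exact hv
    exact hφv ▸ ⟨hvω, hvK⟩
  have hcomp : fderiv ℝ K 0 = (fderiv ℝ L 0).comp φ' := by
    have hLφ : HasFDerivAt (L ∘ φ) ((fderiv ℝ L 0).comp φ') 0 :=
      HasFDerivAt.comp (0 : EuclideanSpace ℝ (Fin n)) (hφ0.symm ▸ hL'.hasFDerivAt) hφ'.hasFDerivAt
    refine hK'.hasFDerivAt.unique (hLφ.congr_of_eventuallyEq ?_)
    filter_upwards [hV₁] with x hx using (key x hx).2.symm
  have hinj : Function.Injective φ' := by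
    rw [hcomp, ContinuousLinearMap.coe_comp] at hDK
    exact hDK.of_comp
  have hsurj : φ'.range = ⊤ :=
    LinearMap.range_eq_top.2 ((LinearMap.injective_iff_surjective (f := φ'.toLinearMap)).1 hinj)
  have hmap := hφ'.map_nhds_eq_of_surj hsurj
  rw [hφ0] at hmap
  refine ⟨V₁, hV₁, φ '' V₁, hmap ▸ Filter.image_mem_map hV₁, hV₁ω, ?_, ?_⟩
  · exact image_subset_iff.2 fun x hx => (key x hx).1
  · rw [image_image]
    exact image_congr fun x hx => (key x hx).2.symm
end

section
/- Let n ≥ 2, let t ∈ ℝ^{n−1} with ‖t‖ < 1, and for ξ ∈ ℂ let Θ_t(ξ) be the n×n complex matrix with (1,1)-entry i·√(1−‖t‖²), (1,j)-entry −t_j·ξ/√(1−‖t‖²) for j = 2,…,n, and lower-right (n−1)×(n−1) block the identity with zero first column below the first row. Then ξ ↦ Θ_t(ξ) is holomorphic on all of ℂ with Θ_t(ξ) invertible for every ξ, and for every ξ ∈ ∂Δ the real linear span of the n columns of the matrix product Θ_t(ξ)·diag(ξ,1,…,1) equals the tangent space T_{𝔤_t(ξ)}Sⁿ = {v ∈ ℂⁿ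 : Re(conj(√(1−‖t‖²)·ξ)·v₁) + Σ_{j=2}^{n} t_j·Re(v_j) = 0 and Im(v_j) = 0 for j = 2,…,n}. (This exhibits the partial indices of Sⁿ along the disc 𝔤_t as 2,0,…,0.) -/
open Complex Set Function
open scoped Real

noncomputable section

/-- The point `e^{iθ}` on the unit circle `∂Δ`. -/
def cir (θ : ℝ) : ℂ := Complex.exp (θ * Complex.I)

/-- The matrix `Θ_t(ξ)`: `(1,1)`-entry `i√(1-‖t‖²)`, `(1,j)`-entry `-t_j ξ/√(1-‖t‖²)` for
`j ≥ 2`, and lower-right block the identity with zero first column below the first row. -/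
def ThetaMat (m : ℕ) (t : EuclideanSpace ℝ (Fin m)) (ξ : ℂ) :
    Matrix (Fin (m + 1)) (Fin (m + 1)) ℂ :=
  Matrix.of fun i j =>
    if i = 0 then
      (if hj : j = 0 then Complex.I * ((Real.sqrt (1 - ‖t‖ ^ 2) : ℝ) : ℂ)
       else -(((t (j.pred hj)) : ℝ) : ℂ) * ξ / ((Real.sqrt (1 - ‖t‖ ^ 2) : ℝ) : ℂ))
    else (if i = j then 1 else 0)

lemma conj_cir_mul_cir (θ : ℝ) : (starRingEnd ℂ) (cir θ) * cir θ = 1 := by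
  rw [mul_comm, Complex.mul_conj, Complex.normSq_eq_norm_sq, cir, Complex.norm_exp_ofReal_mul_I]
  simp

lemma thetaMat_zero_zero (m : ℕ) (t : EuclideanSpace ℝ (Fin m)) (ξ : ℂ) :
    ThetaMat m t ξ 0 0 = Complex.I * ((Real.sqrt (1 - ‖t‖ ^ 2) : ℝ) : ℂ) := by
  simp [ThetaMat]

lemma thetaMat_zero_succ (m : ℕ) (t : EuclideanSpace ℝ (Fin m)) (ξ : ℂ) (j : Fin m) :
    ThetaMat m t ξ 0 j.succ = -((t j : ℝ) : ℂ) * ξ / ((Real.sqrt (1 - ‖t‖ ^ 2) : ℝ) : ℂ) := by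
  simp [ThetaMat]

lemma thetaMat_succ (m : ℕ) (t : EuclideanSpace ℝ (Fin m)) (ξ : ℂ) (i : Fin m)
    (j : Fin (m + 1)) :
    ThetaMat m t ξ i.succ j = if i.succ = j then 1 else 0 := by
  simp [ThetaMat]

lemma det_thetaMat (m : ℕ) (t : EuclideanSpace ℝ (Fin m)) (ξ : ℂ) :
    (ThetaMat m t ξ).det = Complex.I * ((Real.sqrt (1 - ‖t‖ ^ 2) : ℝ) : ℂ) := by
  rw [Matrix.det_of_isUpperTriangular, Fin.prod_univ_succ]
  · simp [thetaMat_zero_zero, thetaMat_succ]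
  · intro i j hij
    obtain ⟨k, rfl⟩ := Fin.exists_succ_eq.mpr (Fin.ne_zero_of_lt hij)
    rw [thetaMat_succ, if_neg (ne_of_gt (show j < k.succ from hij))]

/-- Real combinations of the columns of `Θ_t(ξ)·diag(ξ,1,…,1)`: the first coordinate is `ξ` times
a number whose imaginary part is governed by the first coefficient, and the remaining coordinates
are the remaining coefficients. -/
lemma sum_smul_columns_eq_iff (m : ℕ) (t : EuclideanSpace ℝ (Fin m)) (ξ : ℂ)
    (a : Fin (m + 1) → ℝ) (v : Fin (m + 1) → ℂ) :
    (∑ j, a j • (fun i : Fin (m + 1) => (ThetaMat m t ξ *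
        Matrix.diagonal (fun l : Fin (m + 1) => if l = 0 then ξ else 1)) i j)) = v ↔
      ξ * (((a 0 * Real.sqrt (1 - ‖t‖ ^ 2) : ℝ) : ℂ) * Complex.I -
        (((∑ j : Fin m, t j * a j.succ) / Real.sqrt (1 - ‖t‖ ^ 2) : ℝ) : ℂ)) = v 0 ∧
      ∀ j : Fin m, (a j.succ : ℂ) = v j.succ := by
  rw [funext_iff, Fin.forall_fin_succ]
  refine and_congr (Eq.congr_left ?_) (forall_congr' fun k => Eq.congr_left ?_)
  · simp only [Finset.sum_apply, Pi.smul_apply, Matrix.mul_diagonal, Fin.sum_univ_succ,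
      thetaMat_zero_zero, thetaMat_zero_succ, Fin.succ_ne_zero, if_true, if_false,
      Complex.real_smul]
    generalize Real.sqrt (1 - ‖t‖ ^ 2) = s
    push_cast
    rw [mul_sub, sub_eq_add_neg, Finset.sum_div, Finset.mul_sum, ← Finset.sum_neg_distrib]
    congr 1
    · ring
    · exact Finset.sum_congr rfl fun j _ => by ring
  · simp [Finset.sum_apply, Matrix.mul_diagonal, thetaMat_succ, Fin.sum_univ_succ]

/-- **Statement 16.**  For `‖t‖ < 1`, the matrix function `ξ ↦ Θ_t(ξ)` is entire with `Θ_t(ξ)`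
invertible for every `ξ`, and for `ξ ∈ ∂Δ` the real span of the columns of
`Θ_t(ξ)·diag(ξ,1,…,1)` is the tangent space `T_{𝔤_t(ξ)}Sⁿ`.  (This exhibits the partial
indices of `Sⁿ` along `𝔤_t` as `2,0,…,0`.) -/
theorem statement16 (m : ℕ) (hm : 1 ≤ m) (t : EuclideanSpace ℝ (Fin m)) (ht : ‖t‖ < 1) :
    (∀ i j : Fin (m + 1), Differentiable ℂ (fun ξ : ℂ => ThetaMat m t ξ i j)) ∧
    (∀ ξ : ℂ, IsUnit (ThetaMat m t ξ)) ∧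
    (∀ θ : ℝ,
      (Submodule.span ℝ (Set.range (fun j : Fin (m + 1) => fun i : Fin (m + 1) =>
          (ThetaMat m t (cir θ) *
            Matrix.diagonal (fun l : Fin (m + 1) => if l = 0 then cir θ else 1)) i j)) :
        Set (Fin (m + 1) → ℂ)) =
      {v : Fin (m + 1) → ℂ |
        ((starRingEnd ℂ) (((Real.sqrt (1 - ‖t‖ ^ 2) : ℝ) : ℂ) * cir θ) * v 0).re +
            ∑ j : Fin m, t j * (v j.succ).re = 0 ∧
          ∀ i : Fin (m + 1), i ≠ 0 → (v i).im = 0}) := by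
  have hs : 0 < Real.sqrt (1 - ‖t‖ ^ 2) :=
    Real.sqrt_pos.mpr (by nlinarith [norm_nonneg t])
  refine ⟨fun i j => ?_, fun ξ => ?_, fun θ => ?_⟩
  · refine Fin.cases ?_ (fun k => ?_) i
    · refine Fin.cases ?_ (fun l => ?_) j
      · simp only [thetaMat_zero_zero]
        fun_prop
      · simp only [thetaMat_zero_succ]
        fun_prop
    · simp only [thetaMat_succ]
      fun_prop
  · rw [Matrix.isUnit_iff_isUnit_det, det_thetaMat, isUnit_iff_ne_zero]
    exact mul_ne_zero Complex.I_ne_zero (Complex.ofReal_ne_zero.mpr hs.ne')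
  · have hc := conj_cir_mul_cir θ
    ext v
    rw [SetLike.mem_coe, Submodule.mem_span_range_iff_exists_fun, Set.mem_ofPred_eq]
    simp only [sum_smul_columns_eq_iff]
    generalize Real.sqrt (1 - ‖t‖ ^ 2) = s at hs ⊢
    constructor
    · rintro ⟨a, h0, h1⟩
      constructor
      · simp only [← h0, ← h1, map_mul, Complex.conj_ofReal, Complex.ofReal_re]
        rw [mul_assoc, ← mul_assoc _ (cir θ), hc, one_mul, Complex.re_ofReal_mul]
        simp only [Complex.sub_re, Complex.re_ofReal_mul, Complex.I_re, Complex.ofReal_re]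
        field_simp
        ring
      · intro i hi
        obtain ⟨k, rfl⟩ := Fin.exists_succ_eq.mpr hi
        rw [← h1, Complex.ofReal_im]
    · rintro ⟨h0, h1⟩
      refine ⟨Fin.cons (((starRingEnd ℂ) (cir θ) * v 0).im / s) fun j => (v j.succ).re, ?_,
        fun j => ?_⟩
      · simp only [Fin.cons_zero, Fin.cons_succ]
        rw [map_mul, Complex.conj_ofReal, mul_assoc, Complex.re_ofReal_mul] at h0
        have hre : (∑ j : Fin m, t j * (v j.succ).re) / s =
            -((starRingEnd ℂ) (cir θ) * v 0).re := by
          rw [div_eq_iff hs.ne']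
          linarith
        rw [hre, div_mul_cancel₀ _ hs.ne', Complex.ofReal_neg, sub_neg_eq_add, add_comm,
          Complex.re_add_im, ← mul_assoc, mul_comm (cir θ), hc, one_mul]
      · rw [Fin.cons_succ]
        exact Complex.ext rfl (by rw [Complex.ofReal_im, h1 _ (Fin.succ_ne_zero j)])

end
end

section
/- Let n ≥ 1, let W ⊆ ℂⁿ be an ℝ-linear subspace with dim_ℝ W = n which is totally real, i.e. W ∩ iW = {0}. Let X₁,…,Xₙ be an ℝ-basis of W, and let ν₁,…,νₙ ∈ ℂⁿ be vectors spanning the orthogonal complement of W in ℂⁿ ≅ ℝ^{2n} with respect to the real inner product ⟨z,w⟩ = Re Σ_j z_j·conj(w_j). Then the real n×n matrix C with entries C_{jk} = ⟨ν_j, i·X_k⟩ is invertible. -/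
open Complex Set Function

/-- The real inner product `⟨z, w⟩ = Re Σ_j z_j conj(w_j)` on `ι → ℂ`, as a bilinear form. -/
noncomputable def realInnerForm (ι : Type*) [Fintype ι] : LinearMap.BilinForm ℝ (ι → ℂ) :=
  LinearMap.mk₂ ℝ (fun u w => (∑ j, u j * (starRingEnd ℂ) (w j)).re)
    (fun u v w => by simp only [Pi.add_apply, add_mul, Finset.sum_add_distrib, Complex.add_re])
    (fun c u w => by
      simp [Finset.mul_sum]
      exact Finset.sum_congr rfl fun _ _ => by ring)
    (fun u v w => by
      simp only [Pi.add_apply, map_add, mul_add, Finset.sum_add_distrib, Complex.add_re])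
    (fun c u w => by
      simp [Finset.mul_sum]
      exact Finset.sum_congr rfl fun _ _ => by ring)

section

variable {ι : Type*} [Fintype ι]

theorem realInnerForm_apply (u w : ι → ℂ) :
    realInnerForm ι u w = (∑ j, u j * (starRingEnd ℂ) (w j)).re :=
  rfl

theorem realInnerForm_isSymm : (realInnerForm ι).IsSymm := by
  refine ⟨fun u w => ?_⟩
  simp [realInnerForm_apply, mul_comm]

theorem realInnerForm_self_eq_zero {u : ι → ℂ} (h : realInnerForm ι u u = 0) : u = 0 := by
  simp only [realInnerForm_apply, Complex.mul_conj, Complex.re_sum, Complex.ofReal_re] at h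
  rw [Finset.sum_eq_zero_iff_of_nonneg fun i _ => Complex.normSq_nonneg _] at h
  funext i
  exact Complex.normSq_eq_zero.mp (h i (Finset.mem_univ i))

theorem realInnerForm_nondegenerate : (realInnerForm ι).Nondegenerate :=
  ⟨fun u h => realInnerForm_self_eq_zero (h u), fun u h => realInnerForm_self_eq_zero (h u)⟩

end

/-- **Statement 17.**  Let `W ⊆ ℂⁿ` be a totally real `ℝ`-subspace of real dimension `n`
(`W ∩ iW = {0}`), let `X₁, …, Xₙ` be an `ℝ`-basis of `W`, and let `ν₁, …, νₙ` span the
orthogonal complement of `W` in `ℂⁿ ≅ ℝ^{2n}` for the real inner product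
`⟨z, w⟩ = Re Σ_j z_j conj(w_j)`.  Then the real `n × n` matrix `C` with entries
`C_{jk} = ⟨ν_j, i Xₖ⟩` is invertible. -/
theorem statement17 (n : ℕ) (hn : 1 ≤ n) (W : Submodule ℝ (Fin n → ℂ))
    (hdim : Module.finrank ℝ W = n)
    (htr : ∀ v ∈ W, (fun j => Complex.I * v j) ∈ W → v = 0)
    (X : Fin n → Fin n → ℂ) (hXmem : ∀ j, X j ∈ W)
    (hXli : LinearIndependent ℝ X)
    (hXspan : Submodule.span ℝ (Set.range X) = W)
    (ν : Fin n → Fin n → ℂ)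
    (hν : (Submodule.span ℝ (Set.range ν) : Set (Fin n → ℂ)) =
      {u | ∀ w ∈ W, (∑ j, u j * (starRingEnd ℂ) (w j)).re = 0}) :
    IsUnit (Matrix.of fun j l : Fin n =>
      (∑ i, ν j i * (starRingEnd ℂ) (Complex.I * X l i)).re) := by
  rw [← Matrix.mulVec_injective_iff_isUnit]
  refine (injective_iff_map_eq_zero (Matrix.mulVecLin _)).mpr fun c hc => ?_
  let J : (Fin n → ℂ) →ₗ[ℝ] (Fin n → ℂ) :=
    (LinearMap.lsmul ℂ (Fin n → ℂ) Complex.I).restrictScalars ℝ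
  have hν_orth : ∀ j, realInnerForm (Fin n) (ν j) (J (∑ k, c k • X k)) = 0 := by
    intro j
    rw [map_sum, map_sum]
    refine Eq.trans (Finset.sum_congr rfl fun k _ => ?_) (congrFun hc j)
    rw [map_smul, map_smul, smul_eq_mul, mul_comm]
    rfl
  have hJ_mem : J (∑ k, c k • X k) ∈ W := by
    rw [← LinearMap.BilinForm.orthogonal_orthogonal realInnerForm_nondegenerate
      realInnerForm_isSymm.isRefl W, LinearMap.BilinForm.mem_orthogonal_iff]
    intro u hu
    have hu_span : u ∈ Submodule.span ℝ (Set.range ν) := by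
      rw [← SetLike.mem_coe, hν]
      exact fun w hw => realInnerForm_isSymm.isRefl _ _ (hu w hw)
    refine Submodule.span_induction (p := fun u _ => realInnerForm (Fin n) u _ = 0)
      ?_ ?_ ?_ ?_ hu_span
    · rintro _ ⟨j, rfl⟩
      exact hν_orth j
    · simp
    · intro x y _ _ hx hy
      rw [map_add, LinearMap.add_apply, hx, hy, add_zero]
    · intro a x _ hx
      rw [map_smul, LinearMap.smul_apply, hx, smul_zero]
  have hv : ∑ k, c k • X k = 0 :=
    htr _ (W.sum_mem fun k _ => W.smul_mem _ (hXmem k)) hJ_mem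
  exact funext (Fintype.linearIndependent_iff.mp hXli c hv)
end
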